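/- (Resolvent bound for nonnegative spectral parameter.) Let n ≥ 1, let a : ℝⁿ → ℝⁿ be C¹, let c : ℝⁿ → ℝ be bounded measurable with c ≥ 0 almost everywhere, let μ ≥ 0, let u : ℝⁿ → ℂ be C² with compact support, and set g := Δ_a u + i c u − μ u. Assume there are constants κ > 0 and k > 0 such that ‖u‖_{L²} ≤ κ ‖∇u‖_{L²} and ‖∇u‖_{L²} ≤ k ‖∇_a u‖_{L²}, where ‖∇_a u‖_{L²} = (∫ Σ_j |∂_j u + i a_j u|² dx)^{1/2}. Then ‖u‖_{L²} ≤ κ² k² ‖g‖_{L²}. -/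

import Mathlib

open Complex MeasureTheory

/-- Partial derivative in direction `j` of a complex-valued function on `ℝⁿ`. -/
noncomputable def pd {n : ℕ} (j : Fin n) (u : (Fin n → ℝ) → ℂ) (x : Fin n → ℝ) : ℂ :=
  fderiv ℝ u x (Pi.single j 1)

/-- The `j`-th component of the magnetic gradient `(∂_j + i a_j) u`. -/
noncomputable def mgrad {n : ℕ} (a : (Fin n → ℝ) → Fin n → ℝ) (u : (Fin n → ℝ) → ℂ)
    (j : Fin n) (x : Fin n → ℝ) : ℂ :=
  pd j u x + Complex.I * (a x j) * u x

/-- The magnetic Laplacian `Δ_a u = Σ_j (∂_j + i a_j)((∂_j + i a_j) u)`. -/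
noncomputable def magLap {n : ℕ} (a : (Fin n → ℝ) → Fin n → ℝ) (u : (Fin n → ℝ) → ℂ)
    (x : Fin n → ℝ) : ℂ :=
  ∑ j, mgrad a (fun y => mgrad a u j y) j x


lemma aux_contDiff_mgrad {n : ℕ} {a : (Fin n → ℝ) → Fin n → ℝ} (ha : ContDiff ℝ 1 a)
    {u : (Fin n → ℝ) → ℂ} (hu : ContDiff ℝ 2 u) (j : Fin n) :
    ContDiff ℝ 1 (fun x => mgrad a u j x) := by
  unfold mgrad pd
  have h1 : ContDiff ℝ 1 (fun x => fderiv ℝ u x (Pi.single j 1)) :=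
    (hu.fderiv_right (m := 1) (by norm_num)).clm_apply contDiff_const
  have h2 : ContDiff ℝ 1 (fun x => ((a x j : ℝ) : ℂ)) :=
    Complex.ofRealCLM.contDiff.comp (contDiff_pi.1 ha j)
  exact h1.add ((contDiff_const.mul h2).mul (hu.of_le (by norm_num)))

lemma aux_continuous_mgrad {n : ℕ} {a : (Fin n → ℝ) → Fin n → ℝ} (ha : ContDiff ℝ 1 a)
    {u : (Fin n → ℝ) → ℂ} (hu : ContDiff ℝ 1 u) (j : Fin n) :
    Continuous (fun x => mgrad a u j x) := by
  unfold mgrad pd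
  have h1 : Continuous (fun x => fderiv ℝ u x (Pi.single j 1)) :=
    (hu.continuous_fderiv (by norm_num)).clm_apply continuous_const
  have h2 : Continuous (fun x => ((a x j : ℝ) : ℂ)) :=
    Complex.continuous_ofReal.comp ((continuous_apply j).comp ha.continuous)
  exact h1.add ((continuous_const.mul h2).mul hu.continuous)

lemma aux_supp_mgrad {n : ℕ} (a : (Fin n → ℝ) → Fin n → ℝ)
    {u : (Fin n → ℝ) → ℂ} (hu : HasCompactSupport u) (j : Fin n) :
    HasCompactSupport (fun x => mgrad a u j x) := by
  unfold mgrad pd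
  exact (hu.fderiv_apply (𝕜 := ℝ) (Pi.single j 1)).add (hu.mul_left)

lemma aux_parts {n : ℕ} {a : (Fin n → ℝ) → Fin n → ℝ} (ha : ContDiff ℝ 1 a)
    {u w : (Fin n → ℝ) → ℂ} (hu : ContDiff ℝ 1 u) (hus : HasCompactSupport u)
    (hw : ContDiff ℝ 1 w) (j : Fin n) :
    ∫ x, inner ℝ (u x) (mgrad a w j x) = - ∫ x, inner ℝ (mgrad a u j x) (w x) := by
  have hdu : Continuous (fun x => fderiv ℝ u x (Pi.single j 1)) :=
    (hu.continuous_fderiv (by norm_num)).clm_apply continuous_const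
  have hdw : Continuous (fun x => fderiv ℝ w x (Pi.single j 1)) :=
    (hw.continuous_fderiv (by norm_num)).clm_apply continuous_const
  have h2 : Continuous (fun x => ((a x j : ℝ) : ℂ)) :=
    Complex.continuous_ofReal.comp ((continuous_apply j).comp ha.continuous)
  have hI : ∀ {f h : (Fin n → ℝ) → ℂ}, Continuous f → Continuous h → HasCompactSupport f →
      Integrable (fun x => inner ℝ (f x) (h x)) := by
    intro f h hf hh hs
    refine (hf.inner hh).integrable_of_hasCompactSupport ?_
    refine hs.mono' ?_
    refine subset_trans ?_ (subset_tsupport f)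
    intro x hx hfx
    exact hx (by simp [hfx])
  have key := integral_bilinear_fderiv_right_eq_neg_left_of_integrable
    (μ := (volume : Measure (Fin n → ℝ))) (f := u) (g := w) (v := Pi.single j 1)
    (B := (innerSL ℝ : ℂ →L[ℝ] ℂ →L[ℝ] ℝ))
    (hI hdu hw.continuous (hus.fderiv_apply (𝕜 := ℝ) (Pi.single j 1)))
    (hI hu.continuous hdw hus) (hI hu.continuous hw.continuous hus)
    (fun x _ => (hu.differentiable (by norm_num)) x)
    (fun x _ => (hw.differentiable (by norm_num)) x)
  change ∫ x, inner ℝ (u x) (fderiv ℝ w x (Pi.single j 1))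
      = - ∫ x, inner ℝ (fderiv ℝ u x (Pi.single j 1)) (w x) at key
  have iw : Continuous (fun x => Complex.I * (a x j) * w x) :=
    (continuous_const.mul h2).mul hw.continuous
  have iu : Continuous (fun x => Complex.I * (a x j) * u x) :=
    (continuous_const.mul h2).mul hu.continuous
  unfold mgrad pd
  simp only [inner_add_left, inner_add_right]
  rw [integral_add (hI hu.continuous hdw hus) (hI hu.continuous iw hus),
    integral_add (hI hdu hw.continuous (hus.fderiv_apply (𝕜 := ℝ) (Pi.single j 1)))
      (hI iu hw.continuous hus.mul_left), key, neg_add, ← integral_neg (f := fun x => inner ℝ (Complex.I * (a x j) * u x) (w x))]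
  congr 2
  ext x
  simp [Complex.inner]
  ring

lemma aux_inner_int {n : ℕ} {u g : (Fin n → ℝ) → ℂ} (hu : MemLp u 2) (hg : MemLp g 2) :
    Integrable (fun x => inner ℝ (u x) (g x)) := by
  have h : Integrable (fun x => ‖u x‖ * ‖g x‖) := hu.norm.integrable_mul hg.norm
  refine h.mono' (hu.1.inner hg.1) (Filter.Eventually.of_forall fun x => ?_)
  exact abs_real_inner_le_norm _ _

lemma aux_cs {n : ℕ} {u g : (Fin n → ℝ) → ℂ} (hu : MemLp u 2) (hg : MemLp g 2) :
    ∫ x, ‖u x‖ * ‖g x‖ ≤ Real.sqrt (∫ x, ‖u x‖ ^ 2) * Real.sqrt (∫ x, ‖g x‖ ^ 2) := by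
  have h := integral_mul_norm_le_Lp_mul_Lq (μ := (volume : Measure (Fin n → ℝ)))
    Real.HolderConjugate.two_two (f := u) (g := g) (by simpa using hu) (by simpa using hg)
  simpa [Real.sqrt_eq_rpow] using h

/-- Resolvent bound for nonnegative spectral parameter: `‖u‖ ≤ κ²k²‖g‖` where
`g = Δ_a u + icu − μu` and `μ ≥ 0`, given Poincaré-type inequalities with constants
`κ` and `k`. -/
theorem resolvent_bound_nonneg_parameter {n : ℕ} (hn : 1 ≤ n)
    (a : (Fin n → ℝ) → Fin n → ℝ) (ha : ContDiff ℝ 1 a)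
    (c : (Fin n → ℝ) → ℝ) (hc : Measurable c) (C : ℝ) (hcb : ∀ x, |c x| ≤ C)
    (hc0 : ∀ᵐ x, 0 ≤ c x)
    (μ : ℝ) (hμ : 0 ≤ μ)
    (u : (Fin n → ℝ) → ℂ) (hu : ContDiff ℝ 2 u) (husupp : HasCompactSupport u)
    (g : (Fin n → ℝ) → ℂ)
    (hg : ∀ x, g x = magLap a u x + Complex.I * (c x) * u x - (μ : ℂ) * u x)
    (κ k : ℝ) (hκ : 0 < κ) (hk : 0 < k)
    (hP : Real.sqrt (∫ x, ‖u x‖ ^ 2)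
      ≤ κ * Real.sqrt (∫ x, ∑ j, ‖fderiv ℝ u x (Pi.single j 1)‖ ^ 2))
    (hPa : Real.sqrt (∫ x, ∑ j, ‖fderiv ℝ u x (Pi.single j 1)‖ ^ 2)
      ≤ k * Real.sqrt (∫ x, ∑ j, ‖mgrad a u j x‖ ^ 2)) :
    Real.sqrt (∫ x, ‖u x‖ ^ 2) ≤ κ ^ 2 * k ^ 2 * Real.sqrt (∫ x, ‖g x‖ ^ 2) := by
  have hu1 : ContDiff ℝ 1 u := hu.of_le (by norm_num)
  have hw := fun j => aux_contDiff_mgrad ha hu j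
  have hws := fun j => aux_supp_mgrad a husupp j
  have hLc := fun j => aux_continuous_mgrad ha (hw j) j
  have hLs := fun j => aux_supp_mgrad a (hws j) j
  have hum : MemLp u 2 := hu.continuous.memLp_of_hasCompactSupport husupp
  have hcu : MemLp (fun x => Complex.I * (c x) * u x) 2 := by
    refine hum.of_le_mul (c := C) ?_ ?_
    · exact ((measurable_const.mul (Complex.measurable_ofReal.comp hc)).mul
        hu.continuous.measurable).aestronglyMeasurable
    · refine Filter.Eventually.of_forall fun x => ?_
      simp only [norm_mul, Complex.norm_I, one_mul, Complex.norm_real, Real.norm_eq_abs]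
      exact mul_le_mul_of_nonneg_right (hcb x) (norm_nonneg _)
  have hLm : MemLp (fun x => magLap a u x) 2 := by
    unfold magLap
    exact memLp_finsetSum _ fun j _ => (hLc j).memLp_of_hasCompactSupport (hLs j)
  have hgm : MemLp g 2 := by
    have : g = fun x => magLap a u x + Complex.I * (c x) * u x - (μ : ℂ) * u x := funext hg
    rw [this]
    exact (hLm.add hcu).sub (hum.const_mul _)
  have hIL : ∀ j, Integrable (fun x => inner ℝ (u x) (mgrad a (fun y => mgrad a u j y) j x)) :=
    fun j => aux_inner_int hum ((hLc j).memLp_of_hasCompactSupport (hLs j))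
  have hIw : ∀ j, Integrable (fun x => ‖mgrad a u j x‖ ^ 2) := fun j =>
    ((hw j).continuous.memLp_of_hasCompactSupport (p := 2) (hws j)).norm.integrable_sq
  have hIu : Integrable (fun x => ‖u x‖ ^ 2) := hum.norm.integrable_sq
  have hpt : ∀ x, inner ℝ (u x) (g x)
      = (∑ j, inner ℝ (u x) (mgrad a (fun y => mgrad a u j y) j x)) - μ * ‖u x‖ ^ 2 := by
    intro x
    rw [hg, inner_sub_right, inner_add_right, magLap, inner_sum]
    have e1 : inner ℝ (u x) (Complex.I * (c x) * u x) = 0 := by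
      simp [Complex.inner]; ring
    have e2 : inner ℝ (u x) ((μ : ℂ) * u x) = μ * ‖u x‖ ^ 2 := by
      rw [← Complex.real_smul, inner_smul_right, real_inner_self_eq_norm_sq]
    rw [e1, e2, add_zero]
  have hid : ∫ x, inner ℝ (u x) (g x)
      = -(∫ x, ∑ j, ‖mgrad a u j x‖ ^ 2) - μ * ∫ x, ‖u x‖ ^ 2 := by
    simp_rw [hpt]
    rw [integral_sub (integrable_finsetSum _ fun j _ => hIL j) (hIu.const_mul _),
      integral_finsetSum _ (fun j _ => hIL j), integral_finsetSum _ (fun j _ => hIw j),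
      integral_const_mul, ← Finset.sum_neg_distrib]
    congr 1
    refine Finset.sum_congr rfl fun j _ => ?_
    rw [aux_parts ha hu1 husupp (hw j) j]
    simp_rw [real_inner_self_eq_norm_sq]
  have hle : -(∫ x, inner ℝ (u x) (g x)) ≤ ∫ x, ‖u x‖ * ‖g x‖ := by
    rw [← integral_neg]
    refine integral_mono (aux_inner_int hum hgm).neg (hum.norm.integrable_mul hgm.norm) ?_
    intro x
    exact (neg_le_abs _).trans (abs_real_inner_le_norm _ _)
  have hcs := aux_cs hum hgm
  have hU2 : 0 ≤ ∫ x, ‖u x‖ ^ 2 := integral_nonneg fun x => by positivity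
  have hN0 : 0 ≤ ∫ x, ∑ j, ‖mgrad a u j x‖ ^ 2 := integral_nonneg fun x => by positivity
  have hμU := mul_nonneg hμ hU2
  have hN : ∫ x, ∑ j, ‖mgrad a u j x‖ ^ 2
      ≤ Real.sqrt (∫ x, ‖u x‖ ^ 2) * Real.sqrt (∫ x, ‖g x‖ ^ 2) := by linarith
  have hUN := hP.trans (mul_le_mul_of_nonneg_left hPa hκ.le)
  have hsq := Real.sq_sqrt hN0
  have hU := Real.sqrt_nonneg (∫ x, ‖u x‖ ^ 2)
  have hG := Real.sqrt_nonneg (∫ x, ‖g x‖ ^ 2)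
  generalize Real.sqrt (∫ x, ‖u x‖ ^ 2) = U at *
  generalize Real.sqrt (∫ x, ‖g x‖ ^ 2) = G at *
  generalize (∫ x, ∑ j, ‖mgrad a u j x‖ ^ 2) = N at *
  rcases hU.eq_or_lt with h0 | h0
  · rw [← h0]; positivity
  · have h1 : U ^ 2 ≤ (κ * (k * √N)) ^ 2 := pow_le_pow_left₀ hU hUN 2
    have h2 : U * U ≤ U * (κ ^ 2 * k ^ 2 * G) := by
      calc U * U = U ^ 2 := by ring
        _ ≤ (κ * (k * √N)) ^ 2 := h1
        _ = κ ^ 2 * k ^ 2 * N := by rw [mul_pow, mul_pow, hsq]; ring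
        _ ≤ κ ^ 2 * k ^ 2 * (U * G) := by gcongr
        _ = U * (κ ^ 2 * k ^ 2 * G) := by ring
    exact le_of_mul_le_mul_left h2 h0
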